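/- arXiv:2009.05869 — 2 statements merged into one kernel-verified Lean document; each statement's English description precedes it below -/
import Mathlib

section
/- Let A ≥ 0 be a real number. There exists n_0 = n_0(A) such that the following holds. Let s_0 ≤ s_1 ≤ s_2 ≤ ⋯ be a non-decreasing sequence of reals satisfying s_m − s_{m−1} ≤ m^A for all m ≥ 1, and for λ > 0 let s̃_λ denote the random variable s_N where N ~ Pois(λ). Then for every integer n and every p ∈ (0,1] with p·n/log n ≥ n_0, | E[s_{Binom(n,p)}] − E[s̃_{pn}] | ≤ p·( E[s̃_{λ⁺}] − E[s̃_{λ⁻}] ) + 13/n^A, where λ^{±} = pn ± (2A+3)·√(2pn·log n). -/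
/-- `E[s_N]` for `N ~ Pois(lam)`: the Poissonization of the sequence `s`. -/
noncomputable def poiExp (s : ℕ → ℝ) (lam : ℝ) : ℝ :=
  ∑' m : ℕ, (Real.exp (-lam) * lam ^ m / (m.factorial : ℝ)) * s m

/-- `E[s_N]` for `N ~ Binom(n, p)`. -/
noncomputable def binomExp (s : ℕ → ℝ) (n : ℕ) (p : ℝ) : ℝ :=
  ∑ m ∈ Finset.range (n + 1), (n.choose m : ℝ) * p ^ m * (1 - p) ^ (n - m) * s m

lemma exp_le_quadratic_add_cubic {x : ℝ} (hx : |x| ≤ 1) :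
    Real.exp x ≤ 1 + x + x ^ 2 / 2 + |x| ^ 3 := by
  have h := (abs_le.1 (Real.exp_bound hx (n := 3) (by norm_num))).2
  simp only [Finset.sum_range_succ, Finset.range_zero, Finset.sum_empty, Nat.factorial] at h
  norm_num at h
  have : 0 ≤ |x| ^ 3 := by positivity
  linarith

lemma chernoff_exponent_le {l μ x : ℝ} (hl : 0 ≤ l) (hx : |x| ≤ 1 / 50) (hμ₀ : 0 ≤ μ)
    (hμ : μ ≤ l * (1 + 2 * |x|)) :
    μ * (Real.exp x - 1) ≤ μ * x + 11 / 20 * (l * x ^ 2) := by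
  have h := exp_le_quadratic_add_cubic (hx.trans (by norm_num))
  have h1 : μ * (Real.exp x - 1) ≤ μ * (x + |x| ^ 2 / 2 + |x| ^ 3) :=
    mul_le_mul_of_nonneg_left (by rw [sq_abs]; linarith) hμ₀
  rw [← sq_abs x]
  have hy := abs_nonneg x
  set y := |x|
  have h2 : μ * (y ^ 2 / 2 + y ^ 3) ≤ l * (1 + 2 * y) * (y ^ 2 / 2 + y ^ 3) :=
    mul_le_mul_of_nonneg_right hμ (by positivity)
  have h3 : (1 + 2 * y) * (1 / 2 + y) ≤ 11 / 20 := by nlinarith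
  have h4 := mul_le_mul_of_nonneg_left h3 (show 0 ≤ l * y ^ 2 by positivity)
  linarith

/-- The Poisson probability mass function with real mean `μ`. -/
noncomputable def poissonWeight (μ : ℝ) (m : ℕ) : ℝ :=
  Real.exp (-μ) * μ ^ m / (m.factorial : ℝ)

/-- The binomial probability mass function. -/
noncomputable def binomWeight (n : ℕ) (p : ℝ) (m : ℕ) : ℝ :=
  (n.choose m : ℝ) * p ^ m * (1 - p) ^ (n - m)

/-- `w` is a probability mass function on `ℕ` whose moment generating function is dominated by
that of the Poisson distribution with mean `μ`. -/
structure IsSubPoisson (w : ℕ → ℝ) (μ : ℝ) : Prop where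
  nonneg : ∀ m, 0 ≤ w m
  hasSum : HasSum w 1
  mgf : ∀ θ : ℝ, ∃ M ≤ Real.exp (μ * (Real.exp θ - 1)),
    HasSum (fun m : ℕ => w m * Real.exp (θ * m)) M

lemma hasSum_poissonWeight_mul_exp (μ θ : ℝ) :
    HasSum (fun m : ℕ => poissonWeight μ m * Real.exp (θ * m))
      (Real.exp (μ * (Real.exp θ - 1))) := by
  have h := (NormedSpace.expSeries_div_hasSum_exp (μ * Real.exp θ)).mul_left (Real.exp (-μ))
  rw [← Real.exp_eq_exp_ℝ, ← Real.exp_add] at h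
  rw [show μ * (Real.exp θ - 1) = -μ + μ * Real.exp θ by ring]
  refine h.congr_fun fun m => ?_
  rw [poissonWeight, mul_pow, ← Real.exp_nat_mul, mul_comm θ]
  ring

lemma hasSum_poissonWeight (μ : ℝ) : HasSum (poissonWeight μ) 1 := by
  simpa using hasSum_poissonWeight_mul_exp μ 0

lemma isSubPoisson_poissonWeight {μ : ℝ} (hμ : 0 ≤ μ) : IsSubPoisson (poissonWeight μ) μ where
  nonneg m := by unfold poissonWeight; positivity
  hasSum := hasSum_poissonWeight μ
  mgf θ := ⟨_, le_rfl, hasSum_poissonWeight_mul_exp μ θ⟩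

lemma binomWeight_eq_zero {n m : ℕ} (p : ℝ) (h : n < m) : binomWeight n p m = 0 := by
  simp [binomWeight, Nat.choose_eq_zero_of_lt h]

lemma binomWeight_nonneg {p : ℝ} (h₀ : 0 ≤ p) (h₁ : p ≤ 1) (n m : ℕ) :
    0 ≤ binomWeight n p m := by
  have := sub_nonneg.2 h₁
  unfold binomWeight
  positivity

lemma hasSum_binomWeight_mul (n : ℕ) (p : ℝ) (g : ℕ → ℝ) :
    HasSum (fun m => binomWeight n p m * g m)
      (∑ m ∈ Finset.range (n + 1), binomWeight n p m * g m) := by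
  apply hasSum_sum_of_ne_finset_zero
  intro m hm
  rw [binomWeight_eq_zero p (by simpa using hm), zero_mul]

lemma sum_binomWeight_mul_exp (n : ℕ) (p θ : ℝ) :
    ∑ m ∈ Finset.range (n + 1), binomWeight n p m * Real.exp (θ * m) =
      (p * Real.exp θ + (1 - p)) ^ n := by
  rw [add_pow]
  refine Finset.sum_congr rfl fun m _ => ?_
  rw [binomWeight, mul_pow, ← Real.exp_nat_mul, mul_comm θ]
  ring

lemma sum_binomWeight (n : ℕ) (p : ℝ) :
    ∑ m ∈ Finset.range (n + 1), binomWeight n p m = 1 := by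
  simpa using sum_binomWeight_mul_exp n p 0

lemma isSubPoisson_binomWeight {p : ℝ} (h₀ : 0 ≤ p) (h₁ : p ≤ 1) (n : ℕ) :
    IsSubPoisson (binomWeight n p) (p * n) where
  nonneg := binomWeight_nonneg h₀ h₁ n
  hasSum := by
    have h := hasSum_binomWeight_mul n p 1
    simpa [sum_binomWeight] using h
  mgf θ := by
    refine ⟨_, ?_, hasSum_binomWeight_mul n p _⟩
    rw [sum_binomWeight_mul_exp]
    have h : p * Real.exp θ + (1 - p) ≤ Real.exp (p * (Real.exp θ - 1)) := by
      linarith [Real.add_one_le_exp (p * (Real.exp θ - 1))]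
    calc _ ≤ Real.exp (p * (Real.exp θ - 1)) ^ n :=
          pow_le_pow_left₀ (by have := sub_nonneg.2 h₁; positivity) h n
      _ = _ := by rw [← Real.exp_nat_mul]; ring_nf

namespace IsSubPoisson

variable {w : ℕ → ℝ} {μ : ℝ}

lemma summable_and_tsum_le (h : IsSubPoisson w μ) {g : ℕ → ℝ} {C D θ η : ℝ}
    (hC : 0 ≤ C) (hD : 0 ≤ D) (hg₀ : ∀ m, 0 ≤ g m)
    (hg : ∀ m : ℕ, g m ≤ C * Real.exp (θ * m) + D * Real.exp (η * m)) :
    Summable (fun m => w m * g m) ∧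
      ∑' m, w m * g m ≤ C * Real.exp (μ * (Real.exp θ - 1)) +
        D * Real.exp (μ * (Real.exp η - 1)) := by
  obtain ⟨M, hM, hsM⟩ := h.mgf θ
  obtain ⟨N, hN, hsN⟩ := h.mgf η
  have hsum := (hsM.mul_left C).add (hsN.mul_left D)
  have hle : ∀ m, w m * g m ≤
      C * (w m * Real.exp (θ * m)) + D * (w m * Real.exp (η * m)) := fun m => by
    have := mul_le_mul_of_nonneg_left (hg m) (h.nonneg m)
    linarith
  have hs : Summable (fun m => w m * g m) :=
    Summable.of_nonneg_of_le (fun m => mul_nonneg (h.nonneg m) (hg₀ m)) hle hsum.summable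
  refine ⟨hs, (hasSum_le hle hs.hasSum hsum).trans ?_⟩
  gcongr

lemma summable_and_upper_moment_le (h : IsSubPoisson w μ) {A l θ T : ℝ} {n : ℕ} (hA : 0 ≤ A)
    (hl : 0 ≤ l) (hln : l ≤ n) (hθ₀ : 0 ≤ θ) (hθ₁ : θ ≤ 1 / 50) (hμ₀ : 0 ≤ μ)
    (hμ : μ ≤ l * (1 + 2 * θ)) (hT : μ + θ * l ≤ T)
    (hn : ∀ m : ℕ, n ≤ m → (m : ℝ) ^ (A + 1) ≤ Real.exp (m / 2)) :
    Summable (fun m : ℕ => w m * if T ≤ m then (m : ℝ) ^ (A + 1) else 0) ∧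
      ∑' m : ℕ, w m * (if T ≤ m then (m : ℝ) ^ (A + 1) else 0) ≤
        (8 * n : ℝ) ^ (A + 1) * Real.exp (-(9 / 20 * (l * θ ^ 2))) + Real.exp (-(2 * n)) := by
  have hb := h.summable_and_tsum_le (θ := θ) (η := 1)
    (g := fun m : ℕ => if T ≤ m then (m : ℝ) ^ (A + 1) else 0)
    (C := (8 * n : ℝ) ^ (A + 1) * Real.exp (-(θ * T))) (D := Real.exp (-(4 * n)))
    (by positivity) (by positivity) (fun m => by split_ifs <;> positivity) (fun m => by
      split_ifs with hm
      · rcases le_or_gt m (8 * n) with h8 | h8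
        · have h8' : (m : ℝ) ≤ 8 * n := by exact_mod_cast h8
          have h1 : (m : ℝ) ^ (A + 1) ≤ (8 * n : ℝ) ^ (A + 1) :=
            Real.rpow_le_rpow (by positivity) h8' (by linarith)
          have h2 : 1 ≤ Real.exp (-(θ * T)) * Real.exp (θ * m) := by
            rw [← Real.exp_add]
            have := mul_le_mul_of_nonneg_left hm hθ₀
            exact Real.one_le_exp (by linarith)
          have h3 : (8 * n : ℝ) ^ (A + 1) * 1 ≤
              (8 * n : ℝ) ^ (A + 1) * (Real.exp (-(θ * T)) * Real.exp (θ * m)) :=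
            mul_le_mul_of_nonneg_left h2 (by positivity)
          have h4 : 0 ≤ Real.exp (-(4 * n : ℝ)) * Real.exp (1 * m) := by positivity
          linarith
        · have h8' : (8 * n : ℝ) ≤ m := by exact_mod_cast h8.le
          have h1 : Real.exp (m / 2 : ℝ) ≤ Real.exp (-(4 * n : ℝ)) * Real.exp (1 * m) := by
            rw [← Real.exp_add]
            exact Real.exp_le_exp.2 (by linarith)
          have h2 : 0 ≤ (8 * n : ℝ) ^ (A + 1) * Real.exp (-(θ * T)) * Real.exp (θ * m) := by
            positivity
          linarith [hn m (by omega)]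
      · positivity)
  refine ⟨hb.1, hb.2.trans (add_le_add ?_ ?_)⟩
  · rw [mul_assoc, ← Real.exp_add]
    refine mul_le_mul_of_nonneg_left (Real.exp_le_exp.2 ?_) (by positivity)
    have := chernoff_exponent_le hl (x := θ) (by rwa [abs_of_nonneg hθ₀]) hμ₀
      (by rwa [abs_of_nonneg hθ₀])
    have := mul_le_mul_of_nonneg_left hT hθ₀
    nlinarith
  · rw [← Real.exp_add]
    refine Real.exp_le_exp.2 ?_
    have he := Real.exp_one_lt_d9
    have hμn : μ ≤ 52 / 50 * n := by nlinarith
    have : μ * (Real.exp 1 - 1) ≤ μ * (18 / 10) := mul_le_mul_of_nonneg_left (by linarith) hμ₀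
    have hn0 : (0 : ℝ) ≤ n := by positivity
    linarith

lemma summable_and_lower_tail_le (h : IsSubPoisson w μ) {l θ T : ℝ}
    (hl : 0 ≤ l) (hθ₀ : 0 ≤ θ) (hθ₁ : θ ≤ 1 / 50) (hμ₀ : 0 ≤ μ)
    (hμ : μ ≤ l * (1 + 2 * θ)) (hT : T ≤ μ - θ * l) :
    Summable (fun m : ℕ => w m * if (m : ℝ) < T then 1 else 0) ∧
      ∑' m : ℕ, w m * (if (m : ℝ) < T then 1 else 0) ≤ Real.exp (-(9 / 20 * (l * θ ^ 2))) := by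
  have hb := h.summable_and_tsum_le (θ := -θ) (η := 0)
    (g := fun m : ℕ => if (m : ℝ) < T then 1 else 0)
    (C := Real.exp (θ * T)) (D := 0)
    (by positivity) le_rfl (fun m => by split_ifs <;> positivity) (fun m => by
      split_ifs with hm
      · rw [← Real.exp_add, zero_mul, add_zero]
        have := mul_le_mul_of_nonneg_left hm.le hθ₀
        exact Real.one_le_exp (by linarith)
      · positivity)
  refine ⟨hb.1, hb.2.trans ?_⟩
  rw [zero_mul, add_zero, ← Real.exp_add]
  refine Real.exp_le_exp.2 ?_
  have := chernoff_exponent_le hl (x := -θ) (by rwa [abs_neg, abs_of_nonneg hθ₀]) hμ₀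
    (by rwa [abs_neg, abs_of_nonneg hθ₀])
  have := mul_le_mul_of_nonneg_left hT hθ₀
  nlinarith

end IsSubPoisson

lemma succ_mul_poissonWeight_succ (μ : ℝ) (m : ℕ) :
    ((m : ℝ) + 1) * poissonWeight μ (m + 1) = μ * poissonWeight μ m := by
  unfold poissonWeight
  rw [Nat.factorial_succ]
  have : ((m : ℝ) + 1) ≠ 0 := by positivity
  push_cast
  field_simp
  ring

lemma poissonWeight_pos {μ : ℝ} (hμ : 0 < μ) (m : ℕ) : 0 < poissonWeight μ m := by
  unfold poissonWeight; positivity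

/-- Log-concavity of the Poisson mass function. -/
lemma poissonWeight_mul_le {μ : ℝ} (hμ : 0 < μ) {i j : ℕ} (hij : i ≤ j) :
    poissonWeight μ i * poissonWeight μ (j + 1) ≤
      poissonWeight μ (i + 1) * poissonWeight μ j := by
  have hi := succ_mul_poissonWeight_succ μ i
  have hj := succ_mul_poissonWeight_succ μ j
  have h1 := poissonWeight_pos hμ (i + 1)
  have h2 := poissonWeight_pos hμ (j + 1)
  have hc : (i : ℝ) ≤ j := by exact_mod_cast hij
  have h : μ * (poissonWeight μ i * poissonWeight μ (j + 1)) ≤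
      μ * (poissonWeight μ (i + 1) * poissonWeight μ j) := by
    have e1 : μ * (poissonWeight μ i * poissonWeight μ (j + 1)) =
      ((i : ℝ) + 1) * (poissonWeight μ (i + 1) * poissonWeight μ (j + 1)) := by
      rw [← mul_assoc, ← hi]; ring
    have e2 : μ * (poissonWeight μ (i + 1) * poissonWeight μ j) =
      ((j : ℝ) + 1) * (poissonWeight μ (i + 1) * poissonWeight μ (j + 1)) := by
      rw [mul_left_comm, ← hj]; ring
    rw [e1, e2]
    gcongr
  exact le_of_mul_le_mul_left h hμ

/-- `P(N < j)` for `N ~ Pois(μ)`. -/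
noncomputable def poissonCdf (μ : ℝ) (j : ℕ) : ℝ := ∑ i ∈ Finset.range j, poissonWeight μ i

lemma poissonCdf_succ (μ : ℝ) (j : ℕ) :
    poissonCdf μ (j + 1) = poissonCdf μ j + poissonWeight μ j :=
  Finset.sum_range_succ _ _

lemma poissonCdf_mono {μ : ℝ} (hμ : 0 < μ) : Monotone (poissonCdf μ) :=
  monotone_nat_of_le_succ fun j => by
    rw [poissonCdf_succ]; linarith [poissonWeight_pos hμ j]

lemma poissonCdf_nonneg {μ : ℝ} (hμ : 0 < μ) (j : ℕ) : 0 ≤ poissonCdf μ j :=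
  Finset.sum_nonneg fun i _ => (poissonWeight_pos hμ i).le

lemma one_sub_poissonCdf (μ : ℝ) (j : ℕ) :
    HasSum (fun i => poissonWeight μ (i + j)) (1 - poissonCdf μ j) :=
  (hasSum_nat_add_iff' j).2 (hasSum_poissonWeight μ)

lemma poissonCdf_le_one {μ : ℝ} (hμ : 0 < μ) (j : ℕ) : poissonCdf μ j ≤ 1 :=
  sub_nonneg.1 ((one_sub_poissonCdf μ j).nonneg fun _ => (poissonWeight_pos hμ _).le)

lemma poissonCdf_mul_le {μ : ℝ} (hμ : 0 < μ) (j : ℕ) :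
    poissonCdf μ (j + 1) * poissonWeight μ (j + 1) ≤
      poissonCdf μ (j + 2) * poissonWeight μ j := by
  have h : poissonCdf μ (j + 1) * poissonWeight μ (j + 1) ≤
      (∑ i ∈ Finset.range (j + 1), poissonWeight μ (i + 1)) * poissonWeight μ j := by
    rw [poissonCdf, Finset.sum_mul, Finset.sum_mul]
    exact Finset.sum_le_sum fun i hi =>
      poissonWeight_mul_le hμ (Nat.lt_succ_iff.1 (Finset.mem_range.1 hi))
  refine h.trans (mul_le_mul_of_nonneg_right ?_ (poissonWeight_pos hμ j).le)
  rw [poissonCdf, Finset.sum_range_succ' _ (j + 1)]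
  linarith [poissonWeight_pos hμ 0]

lemma one_sub_poissonCdf_mul_le {μ : ℝ} (hμ : 0 < μ) (j : ℕ) :
    (1 - poissonCdf μ (j + 2)) * poissonWeight μ j ≤
      (1 - poissonCdf μ (j + 1)) * poissonWeight μ (j + 1) := by
  refine hasSum_le (fun i => ?_) ((one_sub_poissonCdf μ (j + 2)).mul_right _)
    ((one_sub_poissonCdf μ (j + 1)).mul_right _)
  have := poissonWeight_mul_le hμ (show j ≤ i + (j + 1) by omega)
  rw [show i + (j + 2) = i + (j + 1) + 1 by ring]
  linarith

/-- Solution of the Stein equation for the Poisson distribution and the half-line `{m | m < K}`. -/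
noncomputable def steinSol (μ : ℝ) (K : ℕ) : ℕ → ℝ
  | 0 => 0
  | j + 1 => poissonCdf μ (min (j + 1) K) * (1 - poissonCdf μ (max (j + 1) K)) /
      (μ * poissonWeight μ j)

lemma stein_equation {μ : ℝ} (hμ : 0 < μ) (K j : ℕ) :
    μ * steinSol μ K (j + 1) - j * steinSol μ K j =
      (if j < K then 1 else 0) - poissonCdf μ K := by
  have hj := poissonWeight_pos hμ j
  have h1 : μ * steinSol μ K (j + 1) =
      poissonCdf μ (min (j + 1) K) * (1 - poissonCdf μ (max (j + 1) K)) / poissonWeight μ j := by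
    rw [steinSol]; field_simp
  have h2 : j * steinSol μ K j =
      poissonCdf μ (min j K) * (1 - poissonCdf μ (max j K)) / poissonWeight μ j := by
    cases j with
    | zero => simp [poissonCdf]
    | succ i =>
      have hi := poissonWeight_pos hμ i
      rw [steinSol, ← succ_mul_poissonWeight_succ]
      push_cast
      have : (i : ℝ) + 1 ≠ 0 := by positivity
      field_simp
  rw [h1, h2]
  split_ifs with h
  · rw [min_eq_left (by omega), min_eq_left h.le, max_eq_right (by omega), max_eq_right h.le,
      poissonCdf_succ]
    field_simp
    ring
  · rw [min_eq_right (by omega), min_eq_right (by omega), max_eq_left (by omega),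
      max_eq_left (by omega), poissonCdf_succ]
    field_simp
    ring

lemma abs_steinSol_sub_le {μ : ℝ} (hμ : 0 < μ) (K j : ℕ) :
    |steinSol μ K (j + 2) - steinSol μ K (j + 1)| ≤ 1 / μ := by
  have hx := poissonWeight_pos hμ j
  have hy := poissonWeight_pos hμ (j + 1)
  have m1 := poissonCdf_mul_le hμ j
  have m2 := one_sub_poissonCdf_mul_le hμ j
  have hP := poissonCdf_nonneg hμ (j + 1)
  have hG := poissonCdf_le_one hμ (j + 2)
  have hs := poissonCdf_succ μ (j + 1)
  rw [steinSol, steinSol]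
  set x := poissonWeight μ j
  set y := poissonWeight μ (j + 1)
  set P := poissonCdf μ (j + 1)
  obtain ⟨G, hGd⟩ : ∃ G, G = 1 - poissonCdf μ (j + 2) := ⟨_, rfl⟩
  have e2 : poissonCdf μ (j + 2) = P + y := hs
  have hG0 : 0 ≤ G := by linarith
  have hxy : 0 < μ * (x * y) := by positivity
  rw [e2] at m1 m2 hGd
  have m1G := mul_le_mul_of_nonneg_right m1 hG0
  have m2P := mul_le_mul_of_nonneg_right m2 hP
  have m1y := mul_le_mul_of_nonneg_right m1 hy.le
  have hsum : P = 1 - y - G := by linarith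
  rcases lt_or_ge (j + 1) K with h | h
  · rw [min_eq_left (by omega), min_eq_left (by omega), max_eq_right (by omega),
      max_eq_right (by omega)]
    have hk : 1 - poissonCdf μ K ≤ G := by
      have := poissonCdf_mono hμ (show j + 2 ≤ K by omega)
      rw [e2] at this
      linarith
    have hk0 := sub_nonneg.2 (poissonCdf_le_one hμ K)
    set g := 1 - poissonCdf μ K
    have e : poissonCdf μ (j + 1 + 1) * g / (μ * y) - P * g / (μ * x) =
        g * ((P + y) * x - P * y) / (μ * (x * y)) := by
      rw [hs]; field_simp
    rw [e, abs_of_nonneg (div_nonneg (mul_nonneg hk0 (by linarith)) hxy.le),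
      div_le_div_iff₀ hxy hμ]
    have h1 : g * ((P + y) * x - P * y) ≤ G * ((P + y) * x - P * y) :=
      mul_le_mul_of_nonneg_right hk (by linarith)
    have h2 : G * ((P + y) * x - P * y) ≤ x * y := by
      have hy1 : x * y = x * y * (P + y + G) := by rw [hsum]; ring
      rw [hy1]
      have : 1 - P = G + y := by linarith
      rw [this, ← hGd] at m2P
      linarith
    have := mul_le_mul_of_nonneg_right (h1.trans h2) hμ.le
    linarith
  · rw [min_eq_right (by omega), min_eq_right (by omega), max_eq_left (by omega),
      max_eq_left (by omega)]
    have hk : poissonCdf μ K ≤ P := poissonCdf_mono hμ h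
    have hk0 := poissonCdf_nonneg hμ K
    set g := poissonCdf μ K
    have h1P : 1 - P = G + y := by linarith
    rw [h1P, ← hGd] at m2
    have e : g * (1 - poissonCdf μ (j + 1 + 1)) / (μ * y) - g * (1 - P) / (μ * x) =
        -(g * ((G + y) * y - G * x) / (μ * (x * y))) := by
      rw [hs, ← hGd, h1P]; field_simp; ring
    rw [e, abs_neg, abs_of_nonneg (div_nonneg (mul_nonneg hk0 (by linarith)) hxy.le),
      div_le_div_iff₀ hxy hμ]
    have h1 : g * ((G + y) * y - G * x) ≤ P * ((G + y) * y - G * x) :=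
      mul_le_mul_of_nonneg_right hk (by linarith)
    have h2 : P * ((G + y) * y - G * x) ≤ x * y := by
      have hy1 : x * y = x * y * (P + y + G) := by rw [hsum]; ring
      rw [hy1]
      linarith
    have := mul_le_mul_of_nonneg_right (h1.trans h2) hμ.le
    linarith

lemma binomWeight_succ_succ (N j : ℕ) (p : ℝ) :
    binomWeight (N + 1) p (j + 1) =
      p * binomWeight N p j + (1 - p) * binomWeight N p (j + 1) := by
  unfold binomWeight
  rw [Nat.choose_succ_succ, Nat.add_sub_add_right]
  rcases lt_or_ge j N with h | h
  · rw [show N - j = N - (j + 1) + 1 by omega]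
    push_cast
    ring
  · rw [Nat.choose_eq_zero_of_lt (show N < j + 1 by omega)]
    push_cast
    ring

lemma succ_mul_binomWeight_succ (N j : ℕ) (p : ℝ) :
    ((j : ℝ) + 1) * binomWeight (N + 1) p (j + 1) = (N + 1) * p * binomWeight N p j := by
  have h : ((N : ℝ) + 1) * N.choose j = (N + 1).choose (j + 1) * (j + 1) := by
    exact_mod_cast Nat.add_one_mul_choose_eq N j
  unfold binomWeight
  rw [Nat.add_sub_add_right]
  linear_combination (-(p ^ (j + 1) * (1 - p) ^ (N - j))) * h

lemma sum_binomWeight_succ_mul (N : ℕ) (p : ℝ) (φ : ℕ → ℝ) :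
    ∑ j ∈ Finset.range (N + 2), binomWeight (N + 1) p j * φ j =
      p * ∑ j ∈ Finset.range (N + 1), binomWeight N p j * φ (j + 1) +
        (1 - p) * ∑ j ∈ Finset.range (N + 1), binomWeight N p j * φ j := by
  have h : ∑ j ∈ Finset.range (N + 1), binomWeight N p j * φ j =
      ∑ j ∈ Finset.range (N + 2), binomWeight N p j * φ j := by
    rw [Finset.sum_range_succ _ (N + 1), binomWeight_eq_zero p (Nat.lt_succ_self N)]
    simp
  rw [h, Finset.sum_range_succ' _ (N + 1), Finset.sum_range_succ' _ (N + 1), mul_add,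
    Finset.mul_sum, Finset.mul_sum, ← add_assoc, ← Finset.sum_add_distrib]
  congr 1
  · refine Finset.sum_congr rfl fun j _ => ?_
    rw [binomWeight_succ_succ]
    ring
  · simp [binomWeight]
    ring

lemma sum_binomWeight_succ_mul_id (N : ℕ) (p : ℝ) (φ : ℕ → ℝ) :
    ∑ j ∈ Finset.range (N + 2), binomWeight (N + 1) p j * (j * φ j) =
      (N + 1) * p * ∑ j ∈ Finset.range (N + 1), binomWeight N p j * φ (j + 1) := by
  rw [Finset.sum_range_succ' _ (N + 1), Finset.mul_sum]
  simp only [Nat.cast_zero, zero_mul, mul_zero, add_zero]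
  refine Finset.sum_congr rfl fun j _ => ?_
  have := succ_mul_binomWeight_succ N j p
  push_cast
  linear_combination φ (j + 1) * this

/-- The Kolmogorov distance between `Binom(n, p)` and `Pois(pn)` is at most `p`. -/
lemma abs_sum_binomWeight_sub_poissonCdf_le {n : ℕ} (hn : 0 < n) {p : ℝ} (h₀ : 0 < p)
    (h₁ : p ≤ 1) (K : ℕ) :
    |∑ j ∈ Finset.range (n + 1), binomWeight n p j * (if j < K then 1 else 0) -
      poissonCdf (p * n) K| ≤ p := by
  obtain ⟨N, rfl⟩ : ∃ N, n = N + 1 := ⟨n - 1, by omega⟩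
  have hN : (0 : ℝ) < (N : ℝ) + 1 := by positivity
  have hμ : 0 < p * ((N + 1 : ℕ) : ℝ) := by push_cast; positivity
  set μ : ℝ := p * ((N + 1 : ℕ) : ℝ) with hμd
  set f := steinSol μ K
  have key : ∑ j ∈ Finset.range (N + 1 + 1), binomWeight (N + 1) p j * (if j < K then 1 else 0) -
      poissonCdf μ K =
      μ * p * ∑ j ∈ Finset.range (N + 1), binomWeight N p j * (f (j + 2) - f (j + 1)) := by
    calc _ = ∑ j ∈ Finset.range (N + 2), binomWeight (N + 1) p j *
          ((if j < K then 1 else 0) - poissonCdf μ K) := by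
          simp_rw [mul_sub, Finset.sum_sub_distrib, ← Finset.sum_mul]
          rw [sum_binomWeight, one_mul]
      _ = μ * ∑ j ∈ Finset.range (N + 2), binomWeight (N + 1) p j * f (j + 1) -
          ∑ j ∈ Finset.range (N + 2), binomWeight (N + 1) p j * (j * f j) := by
          rw [Finset.mul_sum, ← Finset.sum_sub_distrib]
          refine Finset.sum_congr rfl fun j _ => ?_
          rw [← stein_equation hμ]
          ring
      _ = _ := by
          rw [sum_binomWeight_succ_mul N p fun j => f (j + 1), sum_binomWeight_succ_mul_id]
          simp_rw [mul_sub, Finset.sum_sub_distrib]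
          rw [hμd]
          push_cast
          ring
  rw [key, abs_mul, abs_of_pos (by positivity)]
  have hb : |∑ j ∈ Finset.range (N + 1), binomWeight N p j * (f (j + 2) - f (j + 1))| ≤ 1 / μ := by
    calc _ ≤ ∑ j ∈ Finset.range (N + 1), |binomWeight N p j * (f (j + 2) - f (j + 1))| :=
          Finset.abs_sum_le_sum_abs _ _
      _ ≤ ∑ j ∈ Finset.range (N + 1), binomWeight N p j * (1 / μ) := by
          refine Finset.sum_le_sum fun j _ => ?_
          have hw := binomWeight_nonneg h₀.le h₁ N j
          rw [abs_mul, abs_of_nonneg hw]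
          exact mul_le_mul_of_nonneg_left (abs_steinSol_sub_le hμ K j) hw
      _ = 1 / μ := by rw [← Finset.sum_mul, sum_binomWeight, one_mul]
  calc _ ≤ μ * p * (1 / μ) := mul_le_mul_of_nonneg_left hb (by positivity)
    _ = p := by field_simp

lemma hasSum_mul_ite_lt (w : ℕ → ℝ) (K : ℕ) :
    HasSum (fun m => w m * if m < K then 1 else 0) (∑ j ∈ Finset.range K, w j) := by
  have h := hasSum_sum_of_ne_finset_zero (L := .unconditional ℕ)
    (f := fun m => w m * if m < K then (1 : ℝ) else 0) (s := Finset.range K)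
    (fun m hm => by simp [Finset.mem_range.not.1 hm])
  rwa [Finset.sum_congr rfl fun m hm => by
    rw [if_pos (Finset.mem_range.1 hm), mul_one]] at h

lemma clamp_eq_sum (s : ℕ → ℝ) {a b : ℕ} (hab : a ≤ b) (m : ℕ) :
    s (max a (min m b)) =
      s a + ∑ k ∈ Finset.Ico a b, (s (k + 1) - s k) * (1 - if m < k + 1 then 1 else 0) := by
  induction b, hab using Nat.le_induction with
  | base => simp
  | succ b hb ih =>
    rw [Finset.sum_Ico_succ_top hb, ← add_assoc, ← ih]
    split_ifs with h
    · rw [min_eq_left (by omega), min_eq_left (by omega)]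
      ring
    · rw [min_eq_right (by omega), min_eq_right (by omega), max_eq_right (by omega),
        max_eq_right hb]
      ring

lemma hasSum_mul_clamp {w : ℕ → ℝ} (hw : HasSum w 1) (s : ℕ → ℝ) {a b : ℕ} (hab : a ≤ b) :
    HasSum (fun m => w m * s (max a (min m b)))
      (s a + ∑ k ∈ Finset.Ico a b, (s (k + 1) - s k) * (1 - ∑ j ∈ Finset.range (k + 1), w j)) := by
  have h := (hw.mul_right (s a)).add (hasSum_sum (s := Finset.Ico a b) fun k _ =>
    (hw.sub (hasSum_mul_ite_lt w (k + 1))).mul_left (s (k + 1) - s k))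
  rw [one_mul] at h
  refine h.congr_fun fun m => ?_
  rw [clamp_eq_sum s hab, mul_add, Finset.mul_sum]
  congr 1
  exact Finset.sum_congr rfl fun k _ => by ring

lemma abs_tsum_mul_clamp_sub_le {v w : ℕ → ℝ} (hv : HasSum v 1) (hw : HasSum w 1) {p : ℝ}
    (hp : ∀ K, |∑ j ∈ Finset.range K, v j - ∑ j ∈ Finset.range K, w j| ≤ p)
    {s : ℕ → ℝ} (hs : Monotone s) {a b : ℕ} (hab : a ≤ b) :
    |∑' m, v m * s (max a (min m b)) - ∑' m, w m * s (max a (min m b))| ≤ p * (s b - s a) := by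
  rw [(hasSum_mul_clamp hv s hab).tsum_eq, (hasSum_mul_clamp hw s hab).tsum_eq,
    add_sub_add_left_eq_sub, ← Finset.sum_sub_distrib]
  refine (Finset.abs_sum_le_sum_abs _ _).trans ?_
  rw [← Finset.sum_Ico_sub s hab, Finset.mul_sum]
  refine Finset.sum_le_sum fun k _ => ?_
  have hk := sub_nonneg.2 (hs (Nat.le_succ k))
  rw [← mul_sub, sub_sub_sub_cancel_left, abs_mul, abs_of_nonneg hk, abs_sub_comm, mul_comm]
  exact mul_le_mul_of_nonneg_right (hp _) hk

lemma abs_binom_cdf_sub_poisson_cdf_le {n : ℕ} (hn : 0 < n) {p : ℝ} (h₀ : 0 < p)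
    (h₁ : p ≤ 1) (K : ℕ) :
    |∑ j ∈ Finset.range K, binomWeight n p j -
      ∑ j ∈ Finset.range K, poissonWeight (p * n) j| ≤ p := by
  rw [(hasSum_mul_ite_lt (binomWeight n p) K).unique (hasSum_binomWeight_mul n p _)]
  exact abs_sum_binomWeight_sub_poissonCdf_le hn h₀ h₁ K

lemma binomExp_eq_tsum (s : ℕ → ℝ) (n : ℕ) (p : ℝ) :
    binomExp s n p = ∑' m, binomWeight n p m * s m :=
  (hasSum_binomWeight_mul n p s).tsum_eq.symm

lemma poiExp_eq_tsum (s : ℕ → ℝ) (μ : ℝ) :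
    poiExp s μ = ∑' m, poissonWeight μ m * s m := rfl

lemma le_rpow_of_increment_le {A : ℝ} (hA : 0 ≤ A) {s : ℕ → ℝ} (hs0 : s 0 = 0)
    (hs : ∀ m : ℕ, 1 ≤ m → s m - s (m - 1) ≤ (m : ℝ) ^ A) (m : ℕ) :
    s m ≤ (m : ℝ) ^ (A + 1) := by
  induction m with
  | zero => rw [hs0]; positivity
  | succ m ih =>
    have h := hs (m + 1) (by omega)
    rw [Nat.add_sub_cancel] at h
    have hm : ((m + 1 : ℕ) : ℝ) = m + 1 := by push_cast; ring
    rw [hm] at h ⊢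
    have h0 : (0 : ℝ) ≤ m := by positivity
    have h1 : (m : ℝ) ^ A ≤ ((m : ℝ) + 1) ^ A := Real.rpow_le_rpow h0 (by linarith) hA
    have h2 := mul_le_mul_of_nonneg_right h1 h0
    rw [Real.rpow_add_one' h0 (by linarith)] at ih
    rw [Real.rpow_add_one' (by linarith) (by linarith)]
    linarith

lemma IsSubPoisson.summable_mul {w : ℕ → ℝ} {μ A : ℝ} (h : IsSubPoisson w μ) (hA : 0 ≤ A) {n : ℕ}
    (hn : ∀ m : ℕ, n ≤ m → (m : ℝ) ^ (A + 1) ≤ Real.exp (m / 2))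
    {s : ℕ → ℝ} (hs₀ : ∀ m, 0 ≤ s m) (hs : ∀ m : ℕ, s m ≤ (m : ℝ) ^ (A + 1)) :
    Summable (fun m => w m * s m) := by
  refine (h.summable_and_tsum_le (θ := 0) (η := 1 / 2) (C := (n : ℝ) ^ (A + 1)) (D := 1)
    (by positivity) (by positivity) hs₀ fun m => (hs m).trans ?_).1
  rw [zero_mul, Real.exp_zero, mul_one, one_mul, show (1 / 2 * m : ℝ) = m / 2 by ring]
  have hn0 : 0 ≤ (n : ℝ) ^ (A + 1) := by positivity
  rcases le_total n m with hm | hm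
  · linarith [hn m hm]
  · have := Real.rpow_le_rpow (by positivity) (show (m : ℝ) ≤ n by exact_mod_cast hm)
      (show 0 ≤ A + 1 by linarith)
    linarith [Real.exp_pos (m / 2 : ℝ)]

/-- The Poisson approximation with all parameters explicit: `θ * l` is half the width of the
window between the mean `l = p * n` and the shifted means, and `ε` bounds the tails. -/
lemma abs_binomExp_sub_poiExp_le {A : ℝ} (hA : 0 ≤ A) {n : ℕ} {p θ l ε : ℝ} (h₀ : 0 < p)
    (h₁ : p ≤ 1) (hl : l = p * n) (hl₀ : 0 < l) (hθ₀ : 0 ≤ θ) (hθ₁ : θ ≤ 1 / 50)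
    (hθl : 1 / 2 ≤ θ * l)
    (hε : (8 * n : ℝ) ^ (A + 1) * Real.exp (-(9 / 20 * (l * θ ^ 2))) ≤ ε)
    (hε' : Real.exp (-(2 * n : ℝ)) ≤ ε)
    (hn : ∀ m : ℕ, n ≤ m → (m : ℝ) ^ (A + 1) ≤ Real.exp (m / 2))
    {s : ℕ → ℝ} (hs : Monotone s) (hs0 : s 0 = 0) (hs' : ∀ m : ℕ, s m ≤ (m : ℝ) ^ (A + 1)) :
    |binomExp s n p - poiExp s l| ≤
      p * (poiExp s (l + 2 * (θ * l)) - poiExp s (l - 2 * (θ * l))) + 7 * ε := by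
  have hn0 : (0 : ℝ) ≤ n := by positivity
  have hln : l ≤ n := by rw [hl]; nlinarith
  have hnpos : 0 < n := by
    have : (0 : ℝ) < n := by linarith
    exact_mod_cast this
  have hsn : ∀ m, 0 ≤ s m := fun m => hs0 ▸ hs (Nat.zero_le m)
  have hθl' : θ * l ≤ 1 / 50 * l := mul_le_mul_of_nonneg_right hθ₁ hl₀.le
  obtain ⟨a, ha⟩ : ∃ a, a = ⌈l - θ * l⌉₊ := ⟨_, rfl⟩
  obtain ⟨b, hb⟩ : ∃ b, b = ⌊l + θ * l⌋₊ := ⟨_, rfl⟩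
  have hlt_a : ∀ m : ℕ, m < a → (m : ℝ) < l - θ * l := fun m hm => Nat.lt_ceil.1 (ha ▸ hm)
  have ha_le : ∀ m : ℕ, a ≤ m → l - θ * l ≤ m := fun m hm => Nat.ceil_le.1 (ha ▸ hm)
  have hb_lt : ∀ m : ℕ, b < m → l + θ * l < m := fun m hm =>
    (Nat.floor_lt (by linarith)).1 (hb ▸ hm)
  have hble : (b : ℝ) ≤ l + θ * l := hb ▸ Nat.floor_le (by linarith)
  have hab : a ≤ b := by
    rw [hb, Nat.le_floor_iff (by linarith), ha]
    have := Nat.ceil_lt_add_one (show 0 ≤ l - θ * l by linarith)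
    linarith
  have hsb : s b ≤ (8 * n : ℝ) ^ (A + 1) :=
    (hs' b).trans (Real.rpow_le_rpow (by positivity) (by linarith) (by linarith))
  have hsa : s a ≤ (8 * n : ℝ) ^ (A + 1) := (hs hab).trans hsb
  set e := Real.exp (-(9 / 20 * (l * θ ^ 2))) with he
  have he0 : 0 < e := Real.exp_pos _
  have near : ∀ w : ℕ → ℝ, IsSubPoisson w l →
      |∑' m, w m * s m - ∑' m, w m * s (max a (min m b))| ≤ 2 * ε := by
    intro w hw
    have hws := hw.summable_mul hA hn hsn hs'
    have hwu := (hasSum_mul_clamp hw.hasSum s hab).summable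
    obtain ⟨us, ub⟩ := hw.summable_and_upper_moment_le hA hl₀.le hln hθ₀ hθ₁ hl₀.le
      (by nlinarith) le_rfl hn
    obtain ⟨ls, lb⟩ := hw.summable_and_lower_tail_le hl₀.le hθ₀ hθ₁ hl₀.le (by nlinarith) le_rfl
    have h1 := hasSum_le (fun m => ?_) hws.hasSum (hwu.hasSum.add us.hasSum)
    · have h2 := hasSum_le (fun m => ?_) hwu.hasSum
        (hws.hasSum.add (ls.hasSum.mul_left (s a)))
      · have h3 := mul_le_mul_of_nonneg_left lb (hsn a)
        have h4 := mul_le_mul_of_nonneg_right hsa he0.le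
        have h5 : 0 < ε := (Real.exp_pos _).trans_le hε'
        exact abs_le.2 ⟨by linarith, by linarith⟩
      · rw [mul_left_comm (s a), ← mul_add]
        refine mul_le_mul_of_nonneg_left ?_ (hw.nonneg m)
        rcases lt_or_ge m a with hm | hm
        · rw [if_pos (hlt_a m hm), max_eq_left (by omega)]
          linarith [hsn m]
        · have : s (max a (min m b)) ≤ s m := hs (by omega)
          have : 0 ≤ s a * (if (m : ℝ) < l - θ * l then 1 else 0) :=
            mul_nonneg (hsn a) (by split_ifs <;> norm_num)
          linarith
    · rw [← mul_add]
      refine mul_le_mul_of_nonneg_left ?_ (hw.nonneg m)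
      rcases le_or_gt m b with hm | hm
      · have : s m ≤ s (max a (min m b)) := hs (by omega)
        have : (0 : ℝ) ≤ if l + θ * l ≤ m then (m : ℝ) ^ (A + 1) else 0 := by
          split_ifs <;> positivity
        linarith
      · rw [if_pos (hb_lt m hm).le]
        linarith [hs' m, hsn (max a (min m b))]
  have plus : s b - ε ≤ poiExp s (l + 2 * (θ * l)) := by
    have hw := isSubPoisson_poissonWeight (show 0 ≤ l + 2 * (θ * l) by linarith)
    have hws := hw.summable_mul hA hn hsn hs'
    obtain ⟨ls, lb⟩ := hw.summable_and_lower_tail_le (T := l + θ * l) hl₀.le hθ₀ hθ₁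
      (by linarith) (by linarith) (by linarith)
    have h2 := hasSum_le (fun m => ?_) (hw.hasSum.mul_right (s b))
        (hws.hasSum.add (ls.hasSum.mul_left (s b)))
    · rw [poiExp_eq_tsum]
      have h3 := mul_le_mul_of_nonneg_left lb (hsn b)
      have h4 := mul_le_mul_of_nonneg_right hsb he0.le
      linarith
    · rw [mul_left_comm (s b), ← mul_add]
      refine mul_le_mul_of_nonneg_left ?_ (hw.nonneg m)
      rcases lt_or_ge m b with hm | hm
      · rw [if_pos ((show (m : ℝ) < b by exact_mod_cast hm).trans_le hble)]
        linarith [hsn m]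
      · have : 0 ≤ s b * (if (m : ℝ) < l + θ * l then 1 else 0) :=
          mul_nonneg (hsn b) (by split_ifs <;> norm_num)
        linarith [hs hm]
  have minus : poiExp s (l - 2 * (θ * l)) ≤ s a + 2 * ε := by
    have hw := isSubPoisson_poissonWeight (show 0 ≤ l - 2 * (θ * l) by linarith)
    have hws := hw.summable_mul hA hn hsn hs'
    obtain ⟨us, ub⟩ := hw.summable_and_upper_moment_le (T := l - θ * l) hA hl₀.le hln hθ₀ hθ₁
      (by linarith) (by linarith) (by linarith) hn
    have h1 := hasSum_le (fun m => ?_) hws.hasSum ((hw.hasSum.mul_right (s a)).add us.hasSum)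
    · rw [poiExp_eq_tsum]
      linarith
    · rw [← mul_add]
      refine mul_le_mul_of_nonneg_left ?_ (hw.nonneg m)
      rcases le_or_gt m a with hm | hm
      · have : (0 : ℝ) ≤ if l - θ * l ≤ m then (m : ℝ) ^ (A + 1) else 0 := by
          split_ifs <;> positivity
        linarith [hs hm]
      · rw [if_pos (ha_le m hm.le)]
        linarith [hs' m, hsn a]
  have hX := isSubPoisson_binomWeight h₀.le h₁ n
  have hY := isSubPoisson_poissonWeight hl₀.le
  rw [← hl] at hX
  have hXY := abs_tsum_mul_clamp_sub_le hX.hasSum hY.hasSum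
    (fun K => hl ▸ abs_binom_cdf_sub_poisson_cdf_le hnpos h₀ h₁ K) hs hab
  have h5 : 0 < ε := (Real.exp_pos _).trans_le hε'
  have h6 : p * (s b - s a) ≤
      p * (poiExp s (l + 2 * (θ * l)) - poiExp s (l - 2 * (θ * l)) + 3 * ε) :=
    mul_le_mul_of_nonneg_left (by linarith) h₀.le
  have h7 : p * (3 * ε) ≤ 1 * (3 * ε) := mul_le_mul_of_nonneg_right h₁ (by linarith)
  have hx := abs_le.1 (near _ hX)
  have hy := abs_le.1 (near _ hY)
  have hxy := abs_le.1 hXY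
  rw [binomExp_eq_tsum, poiExp_eq_tsum s l]
  exact abs_le.2 ⟨by linarith [hx.1, hy.2, hxy.1], by linarith [hx.2, hy.1, hxy.2]⟩

lemma poiExp_sub_const {s : ℕ → ℝ} {μ : ℝ} (c : ℝ)
    (h : Summable fun m => poissonWeight μ m * (s m - c)) :
    poiExp (fun m => s m - c) μ = poiExp s μ - c := by
  have h2 := h.hasSum.add ((hasSum_poissonWeight μ).mul_right c)
  simp only [← mul_add, sub_add_cancel] at h2
  rw [poiExp_eq_tsum, poiExp_eq_tsum, h2.tsum_eq]
  ring

lemma binomExp_sub_const (s : ℕ → ℝ) (n : ℕ) (p c : ℝ) :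
    binomExp (fun m => s m - c) n p = binomExp s n p - c := by
  change ∑ m ∈ Finset.range (n + 1), binomWeight n p m * (s m - c) =
    ∑ m ∈ Finset.range (n + 1), binomWeight n p m * s m - c
  simp_rw [mul_sub, Finset.sum_sub_distrib, ← Finset.sum_mul]
  rw [sum_binomWeight, one_mul]

lemma exists_rpow_le_exp_half (A : ℝ) :
    ∃ N : ℕ, ∀ m : ℕ, N ≤ m → (m : ℝ) ^ A ≤ Real.exp (m / 2) := by
  have h := (isLittleO_rpow_exp_pos_mul_atTop A (show (0 : ℝ) < 1 / 2 by norm_num)).bound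
    one_pos
  have h2 := tendsto_natCast_atTop_atTop (R := ℝ) |>.eventually h
  obtain ⟨N, hN⟩ := Filter.eventually_atTop.1 h2
  refine ⟨N, fun m hm => ?_⟩
  have := hN m hm
  rw [one_mul, Real.norm_of_nonneg (by positivity), Real.norm_of_nonneg (by positivity)] at this
  rwa [show (m / 2 : ℝ) = 1 / 2 * m by ring]

lemma rpow_mul_exp_neg_le {A n L x : ℝ} (hn : 0 < n) (hL : L = Real.log n)
    (hn8 : (8 : ℝ) ^ (A + 1) ≤ n) (hx : (2 * A + 2) * L ≤ x) :
    (8 * n) ^ (A + 1) * Real.exp (-x) ≤ n ^ (-A) := by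
  have h1 : Real.exp (-x) ≤ n ^ (-(2 * A + 2)) := by
    rw [Real.rpow_def_of_pos hn, ← hL]
    exact Real.exp_le_exp.2 (by linarith)
  calc (8 * n) ^ (A + 1) * Real.exp (-x) ≤ (n * n ^ (A + 1)) * n ^ (-(2 * A + 2)) := by
        rw [Real.mul_rpow (by norm_num) hn.le]
        gcongr
    _ = n ^ (-A) := by
        nth_rw 1 [← Real.rpow_one n]
        rw [← Real.rpow_add hn, ← Real.rpow_add hn]
        ring_nf

/-- Let `A ≥ 0`.  There is `n₀ = n₀(A)` such that: for every
non-decreasing sequence `s₀ ≤ s₁ ≤ ⋯` of reals with `s_m − s_{m−1} ≤ m^A` for all `m ≥ 1`,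
every integer `n` and every `p ∈ (0, 1]` with `p·n/log n ≥ n₀`,
`|E[s_{Binom(n,p)}] − E[s̃_{pn}]| ≤ p (E[s̃_{λ⁺}] − E[s̃_{λ⁻}]) + 13/n^A`,
where `λ± = pn ± (2A+3)√(2pn log n)` and `s̃_λ = s_{Pois(λ)}`. -/
theorem stmt17 (A : ℝ) (hA : 0 ≤ A) :
    ∃ n₀ : ℕ, ∀ s : ℕ → ℝ, Monotone s →
      (∀ m : ℕ, 1 ≤ m → s m - s (m - 1) ≤ (m : ℝ) ^ A) →
      ∀ (n : ℕ) (p : ℝ), 0 < p → p ≤ 1 → (n₀ : ℝ) ≤ p * n / Real.log n →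
        |binomExp s n p - poiExp s (p * n)| ≤
          p * (poiExp s (p * n + (2 * A + 3) * Real.sqrt (2 * p * n * Real.log n)) -
                poiExp s (p * n - (2 * A + 3) * Real.sqrt (2 * p * n * Real.log n))) +
            13 / (n : ℝ) ^ A := by
  obtain ⟨N, hN⟩ := exists_rpow_le_exp_half (A + 1)
  obtain ⟨n₀, hn₀⟩ := exists_nat_ge (max (max 2 (5000 * (A + 3 / 2) ^ 2))
    (max (2 * (N : ℝ)) (2 * (8 : ℝ) ^ (A + 1))))
  simp only [max_le_iff] at hn₀
  obtain ⟨⟨hn2, hnA⟩, hnN, hn8⟩ := hn₀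
  refine ⟨n₀, fun s hs hinc n p h₀ h₁ hn => ?_⟩
  obtain ⟨L, hL⟩ : ∃ L, L = Real.log n := ⟨_, rfl⟩
  obtain ⟨l, hl⟩ : ∃ l, l = p * n := ⟨_, rfl⟩
  have h2n : 2 ≤ n := by
    by_contra! h
    interval_cases n <;> simp at hn <;> norm_num [hn] at hn2
  have hnpos : (0 : ℝ) < n := by positivity
  have hL' : 1 / 2 ≤ L := by
    have h : Real.log 2 ≤ Real.log n := Real.log_le_log (by norm_num) (by exact_mod_cast h2n)
    linarith [Real.log_two_gt_d9]
  have hL0 : 0 < L := by linarith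
  have hl0 : 0 < l := by rw [hl]; positivity
  have hln : l ≤ n := by rw [hl]; nlinarith
  rw [← hL, ← hl, le_div_iff₀ hL0] at hn
  have hn₀l : (n₀ : ℝ) / 2 ≤ l := by nlinarith
  have hNn : N ≤ n := by
    have : (N : ℝ) ≤ n := by linarith
    exact_mod_cast this
  have hlL : 5000 * (A + 3 / 2) ^ 2 * L ≤ l :=
    (mul_le_mul_of_nonneg_right hnA hL0.le).trans hn
  rw [show 2 * p * n * Real.log n = 2 * l * L by rw [hl, hL]; ring, ← hl]
  obtain ⟨r, hr⟩ : ∃ r, r = Real.sqrt (2 * l * L) := ⟨_, rfl⟩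
  have hr0 : 0 ≤ r := hr ▸ Real.sqrt_nonneg _
  have hr2 : r ^ 2 = 2 * l * L := hr ▸ Real.sq_sqrt (by positivity)
  rw [← hr]
  obtain ⟨θ, hθ⟩ : ∃ θ, θ = (A + 3 / 2) * r / l := ⟨_, rfl⟩
  have hθl : θ * l = (A + 3 / 2) * r := by rw [hθ]; field_simp
  have hθ0 : 0 ≤ θ := by rw [hθ]; positivity
  have hθsq : l * θ ^ 2 = (A + 3 / 2) ^ 2 * (2 * L) := by
    rw [hθ, div_pow, mul_pow, hr2]; field_simp
  have hθ1 : θ ≤ 1 / 50 := by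
    refine le_of_sq_le_sq ?_ (by norm_num)
    have : l * θ ^ 2 ≤ l * (1 / 50) ^ 2 := by rw [hθsq]; linarith
    exact le_of_mul_le_mul_left this hl0
  have hr1 : 1 ≤ r := by
    refine le_of_sq_le_sq ?_ hr0
    rw [hr2]
    nlinarith
  set s' : ℕ → ℝ := fun m => s m - s 0 with hs'
  have hs'mono : Monotone s' := fun i j hij => sub_le_sub_right (hs hij) _
  have hs'0 : s' 0 = 0 := sub_self _
  have hs'nonneg : ∀ m, 0 ≤ s' m := fun m => sub_nonneg.2 (hs (Nat.zero_le m))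
  have hs'le := le_rpow_of_increment_le hA hs'0 fun m hm => by
    simpa [hs'] using hinc m hm
  have hsum : ∀ μ, 0 ≤ μ → poiExp s' μ = poiExp s μ - s 0 := fun μ hμ =>
    poiExp_sub_const _ ((isSubPoisson_poissonWeight hμ).summable_mul hA hN hs'nonneg hs'le)
  have hε' : Real.exp (-(2 * n : ℝ)) ≤ (n : ℝ) ^ (-A) := by
    rw [Real.exp_neg, Real.rpow_neg hnpos.le]
    refine inv_anti₀ (by positivity) ?_
    calc (n : ℝ) ^ A ≤ (n : ℝ) ^ (A + 1) :=
          Real.rpow_le_rpow_of_exponent_le (by exact_mod_cast (by omega : 1 ≤ n)) (by linarith)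
      _ ≤ Real.exp (n / 2) := hN n hNn
      _ ≤ Real.exp (2 * n) := Real.exp_le_exp.2 (by linarith)
  have hx : (2 * A + 2) * L ≤ 9 / 20 * (l * θ ^ 2) := by
    have : 2 * A + 2 ≤ 9 / 10 * (A + 3 / 2) ^ 2 := by nlinarith
    have := mul_le_mul_of_nonneg_right this hL0.le
    rw [hθsq]
    linarith
  have key := abs_binomExp_sub_poiExp_le hA h₀ h₁ hl hl0 hθ0 hθ1 (by rw [hθl]; nlinarith)
    (rpow_mul_exp_neg_le hnpos hL (by linarith) hx) hε'
    (fun m hm => hN m (hNn.trans hm)) hs'mono hs'0 hs'le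
  have hθl' : θ * l ≤ 1 / 50 * l := mul_le_mul_of_nonneg_right hθ1 hl0.le
  have hθl0 : 0 ≤ θ * l := by positivity
  rw [hs', binomExp_sub_const, ← hs', hsum _ hl0.le, hsum _ (by linarith), hsum _ (by linarith),
    sub_sub_sub_cancel_right, sub_sub_sub_cancel_right, hθl,
    show 2 * ((A + 3 / 2) * r) = (2 * A + 3) * r by ring, Real.rpow_neg hnpos.le] at key
  have hinv : 0 < ((n : ℝ) ^ A)⁻¹ := by positivity
  rw [div_eq_mul_inv]
  linarith
end

section
/- For every integer k ≥ 1, the quantity E[LNDS(w)] − n/k, where w ~ [k]^n is a uniformly random word of length n, is a non-decreasing function of n; that is, for all n ≥ 0, E_{w ~ [k]^{n+1}}[LNDS(w)] − (n+1)/k ≥ E_{w ~ [k]^n}[LNDS(w)] − n/k. -/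
/-- Length of a longest non-decreasing subsequence of a word. -/
noncomputable def LNDS {α : Type*} [LinearOrder α] (w : List α) : ℕ :=
  sSup {n | ∃ u : List α, u.Sublist w ∧ u.Chain' (· ≤ ·) ∧ u.length = n}

/-- Expected LNDS length of a uniformly random word of length `n` over the alphabet
`[k] = {1, …, k}`. -/
noncomputable def expLNDS (k n : ℕ) : ℝ :=
  (∑ u : Fin n → Fin k, (LNDS (List.ofFn fun i => (u i : ℕ) + 1) : ℝ)) / (k : ℝ) ^ n

theorem LNDS_bddAbove {α : Type*} [LinearOrder α] (w : List α) :
    BddAbove {n | ∃ u : List α, u.Sublist w ∧ u.IsChain (· ≤ ·) ∧ u.length = n} :=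
  ⟨w.length, by rintro _ ⟨u, hu, -, rfl⟩; exact hu.length_le⟩

theorem le_LNDS {α : Type*} [LinearOrder α] {u w : List α} (huw : u.Sublist w)
    (hu : u.IsChain (· ≤ ·)) : u.length ≤ LNDS w :=
  le_csSup (LNDS_bddAbove w) ⟨u, huw, hu, rfl⟩

theorem exists_length_eq_LNDS {α : Type*} [LinearOrder α] (w : List α) :
    ∃ u : List α, u.Sublist w ∧ u.IsChain (· ≤ ·) ∧ u.length = LNDS w :=
  Nat.sSup_mem (s := {n | ∃ u : List α, u.Sublist w ∧ u.IsChain (· ≤ ·) ∧ u.length = n})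
    ⟨0, [], List.nil_sublist _, List.IsChain.nil, rfl⟩ (LNDS_bddAbove w)

theorem LNDS_mono {α : Type*} [LinearOrder α] {v w : List α} (h : v.Sublist w) :
    LNDS v ≤ LNDS w := by
  obtain ⟨u, huv, hu, hlen⟩ := exists_length_eq_LNDS v
  exact hlen ▸ le_LNDS (huv.trans h) hu

/-- Appending an upper bound of all letters lengthens a longest non-decreasing subsequence. -/
theorem LNDS_add_one_le_append {α : Type*} [LinearOrder α] {w : List α} {a : α}
    (h : ∀ x ∈ w, x ≤ a) : LNDS w + 1 ≤ LNDS (w ++ [a]) := by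
  obtain ⟨u, huw, hu, hlen⟩ := exists_length_eq_LNDS w
  have hchain : (u ++ [a]).IsChain (· ≤ ·) := by
    refine hu.append (List.isChain_singleton a) fun x hx y hy => ?_
    obtain rfl : a = y := by simpa using hy
    exact h x (huw.subset (List.mem_of_mem_getLast? hx))
  simpa [hlen] using le_LNDS (huw.append (List.Sublist.refl [a])) hchain

/-- Summing over all one-letter extensions of a word, at least the largest letter gains one. -/
theorem mul_LNDS_add_one_le_sum_snoc {k n : ℕ} (hk : 1 ≤ k) (u : Fin n → Fin k) :
    k * LNDS (List.ofFn fun i => (u i : ℕ) + 1) + 1 ≤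
      ∑ a : Fin k, LNDS (List.ofFn fun i => ((Fin.snoc u a : Fin (n + 1) → Fin k) i : ℕ) + 1) := by
  have hsnoc (a : Fin k) :
      (List.ofFn fun i => ((Fin.snoc u a : Fin (n + 1) → Fin k) i : ℕ) + 1) =
        (List.ofFn fun i => (u i : ℕ) + 1) ++ [(a : ℕ) + 1] := by
    rw [List.ofFn_succ']
    simp only [Fin.snoc_castSucc, Fin.snoc_last, List.concat_eq_append]
  simp only [hsnoc]
  set w := List.ofFn fun i => (u i : ℕ) + 1
  have hlast : ∀ x ∈ w, x ≤ k - 1 + 1 := by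
    intro x hx
    obtain ⟨i, rfl⟩ := (List.mem_ofFn' _ _).1 hx
    have := (u i).isLt
    dsimp only
    omega
  calc k * LNDS w + 1
      = ∑ a : Fin k, (LNDS w + if a = ⟨k - 1, by omega⟩ then 1 else 0) := by
        simp [Finset.sum_add_distrib]
    _ ≤ ∑ a : Fin k, LNDS (w ++ [(a : ℕ) + 1]) := by
        refine Finset.sum_le_sum fun a _ => ?_
        split_ifs with ha
        · subst ha
          exact LNDS_add_one_le_append hlast
        · exact LNDS_mono (List.sublist_append_left _ _)

/-- For every `k ≥ 1`, the quantity `E[LNDS(w)] − n/k` for `w ~ [k]^n` is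
non-decreasing in `n`. -/
theorem stmt18 (k : ℕ) (hk : 1 ≤ k) (n : ℕ) :
    expLNDS k n - n / k ≤ expLNDS k (n + 1) - (n + 1 : ℕ) / k := by
  have hk0 : (0 : ℝ) < k := by exact_mod_cast hk
  have hsum : (k : ℝ) * (∑ u : Fin n → Fin k, (LNDS (List.ofFn fun i => (u i : ℕ) + 1) : ℝ))
      + (k : ℝ) ^ n ≤
      ∑ u : Fin (n + 1) → Fin k, (LNDS (List.ofFn fun i => (u i : ℕ) + 1) : ℝ) := by
    rw [← (Fin.snocEquiv fun _ : Fin (n + 1) => Fin k).sum_comp, Fintype.sum_prod_type_right]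
    have h := Finset.sum_le_sum fun (u : Fin n → Fin k) (_ : u ∈ Finset.univ) =>
      mul_LNDS_add_one_le_sum_snoc hk u
    simp only [Finset.sum_add_distrib, ← Finset.mul_sum, Finset.sum_const, Finset.card_univ,
      Fintype.card_fun, Fintype.card_fin, smul_eq_mul, mul_one] at h
    exact_mod_cast h
  have hexp : expLNDS k n + 1 / k ≤ expLNDS k (n + 1) := by
    unfold expLNDS
    rw [le_div_iff₀ (by positivity)]
    refine le_of_eq_of_le ?_ hsum
    field_simp
    ring
  push_cast
  rw [add_div]
  linarith
end
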